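/- Let A, B be positive integers, Q ∈ ℝ^{A×B} with ‖Q‖_F ≠ 0, t ≥ 0 and s a positive integer. Then the minimum of ⟨Q,X⟩_F over {X ∈ ℝ^{A×B} : ‖X‖_F² ≤ t², ‖X‖₀ ≤ s} equals −t·σ_s(Q), where σ_s(Q) = max over index sets S ⊆ {1,…,A}×{1,…,B} with |S| ≤ s of √(∑_{(i,j)∈S} Q_{ij}²). Moreover the minimum over {X : ‖X‖_F² = t², ‖X‖₀ ≤ s} has the same value. -/

import Mathlib

/-- Frobenius inner product of real matrices. -/
noncomputable def fip {m n : ℕ} (X Y : Matrix (Fin m) (Fin n) ℝ) : ℝ :=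
  ∑ i, ∑ j, X i j * Y i j

/-- Frobenius norm of a real matrix. -/
noncomputable def fnorm {m n : ℕ} (X : Matrix (Fin m) (Fin n) ℝ) : ℝ :=
  Real.sqrt (fip X X)

/-- Number of nonzero entries of a matrix (the ℓ0 "norm"). -/
noncomputable def l0 {m n : ℕ} (X : Matrix (Fin m) (Fin n) ℝ) : ℕ :=
  (Finset.univ.filter fun p : Fin m × Fin n => X p.1 p.2 ≠ 0).card

/-- σ_s(Q): the maximum over index sets S of cardinality ≤ s of √(∑_{(i,j)∈S} Q_{ij}²). -/
noncomputable def sigS {m n : ℕ} (s : ℕ) (Q : Matrix (Fin m) (Fin n) ℝ) : ℝ :=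
  (Finset.univ.filter fun S : Finset (Fin m × Fin n) => S.card ≤ s).sup'
    ⟨∅, by simp⟩ (fun S => Real.sqrt (∑ p ∈ S, Q p.1 p.2 ^ 2))

theorem fip_eq_sum {m n : ℕ} (X Y : Matrix (Fin m) (Fin n) ℝ) :
    fip X Y = ∑ p : Fin m × Fin n, X p.1 p.2 * Y p.1 p.2 := by
  rw [fip, Fintype.sum_prod_type]

theorem fnorm_sq {m n : ℕ} (X : Matrix (Fin m) (Fin n) ℝ) :
    fnorm X ^ 2 = ∑ p : Fin m × Fin n, X p.1 p.2 ^ 2 := by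
  have h : fip X X = ∑ p : Fin m × Fin n, X p.1 p.2 ^ 2 := by
    simp only [fip_eq_sum, sq]
  rw [fnorm, Real.sq_sqrt (h ▸ Finset.sum_nonneg fun _ _ => sq_nonneg _), h]

theorem sqrt_sum_sq_le_sigS {m n s : ℕ} (Q : Matrix (Fin m) (Fin n) ℝ)
    {S : Finset (Fin m × Fin n)} (hS : S.card ≤ s) :
    Real.sqrt (∑ p ∈ S, Q p.1 p.2 ^ 2) ≤ sigS s Q :=
  Finset.le_sup' (fun S : Finset (Fin m × Fin n) => Real.sqrt (∑ p ∈ S, Q p.1 p.2 ^ 2))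
    (by simpa using hS)

theorem exists_sigS_eq {m n : ℕ} (s : ℕ) (Q : Matrix (Fin m) (Fin n) ℝ) :
    ∃ S : Finset (Fin m × Fin n), S.card ≤ s ∧
      sigS s Q = Real.sqrt (∑ p ∈ S, Q p.1 p.2 ^ 2) := by
  obtain ⟨S, hS, h⟩ := Finset.exists_mem_eq_sup' (s := Finset.univ.filter
    fun S : Finset (Fin m × Fin n) => S.card ≤ s) ⟨∅, by simp⟩
    (fun S => Real.sqrt (∑ p ∈ S, Q p.1 p.2 ^ 2))
  exact ⟨S, by simpa using hS, h⟩

theorem sigS_pos {m n s : ℕ} (hs : 0 < s) {Q : Matrix (Fin m) (Fin n) ℝ} (hQ : fnorm Q ≠ 0) :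
    0 < sigS s Q := by
  obtain ⟨p, hp⟩ : ∃ p : Fin m × Fin n, Q p.1 p.2 ≠ 0 := by
    by_contra! h
    exact hQ (by simpa [h] using fnorm_sq Q)
  refine lt_of_lt_of_le ?_ (sqrt_sum_sq_le_sigS Q (S := {p}) (by simpa using Nat.succ_le_of_lt hs))
  rw [Finset.sum_singleton]
  positivity

theorem neg_mul_sigS_le_fip {m n s : ℕ} (Q X : Matrix (Fin m) (Fin n) ℝ) {t : ℝ} (ht : 0 ≤ t)
    (hX : fnorm X ^ 2 ≤ t ^ 2) (hs : l0 X ≤ s) : -(t * sigS s Q) ≤ fip Q X := by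
  set S := Finset.univ.filter fun p : Fin m × Fin n => X p.1 p.2 ≠ 0 with hS
  have hsum : fip Q X = -∑ p ∈ S, Q p.1 p.2 * -X p.1 p.2 := by
    simp only [fip_eq_sum, mul_neg, Finset.sum_neg_distrib, neg_neg]
    refine (Finset.sum_subset (Finset.subset_univ S) fun p _ hp => ?_).symm
    have : X p.1 p.2 = 0 := by simpa [hS] using hp
    simp [this]
  have hXS : Real.sqrt (∑ p ∈ S, (-X p.1 p.2) ^ 2) ≤ t := by
    refine Real.sqrt_le_iff.2 ⟨ht, le_trans ?_ hX⟩
    simp only [neg_sq, fnorm_sq]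
    exact Finset.sum_le_sum_of_subset_of_nonneg (Finset.subset_univ S) fun _ _ _ => sq_nonneg _
  rw [hsum, neg_le_neg_iff, mul_comm t]
  refine (Real.sum_mul_le_sqrt_mul_sqrt _ _ _).trans ?_
  have h := sqrt_sum_sq_le_sigS Q (S := S) hs
  exact mul_le_mul h hXS (Real.sqrt_nonneg _) ((Real.sqrt_nonneg _).trans h)

theorem exists_fip_eq_neg_mul_sigS {m n s : ℕ} (hs : 0 < s) {Q : Matrix (Fin m) (Fin n) ℝ}
    (hQ : fnorm Q ≠ 0) (t : ℝ) :
    ∃ X : Matrix (Fin m) (Fin n) ℝ,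
      fnorm X ^ 2 = t ^ 2 ∧ l0 X ≤ s ∧ fip Q X = -(t * sigS s Q) := by
  obtain ⟨S, hcard, hS⟩ := exists_sigS_eq s Q
  have hpos := sigS_pos hs hQ
  have hsq : ∑ p ∈ S, Q p.1 p.2 ^ 2 = sigS s Q ^ 2 := by
    rw [hS, Real.sq_sqrt (Finset.sum_nonneg fun _ _ => sq_nonneg _)]
  set σ := sigS s Q
  refine ⟨Matrix.of fun i j => if (i, j) ∈ S then -(t / σ) * Q i j else 0, ?_, ?_, ?_⟩
  · simp only [fnorm_sq, Matrix.of_apply, Prod.mk.eta, ite_pow, mul_pow, ne_eq,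
      OfNat.ofNat_ne_zero, not_false_eq_true, zero_pow, Finset.sum_ite_mem, Finset.univ_inter]
    rw [← Finset.mul_sum, hsq]
    field_simp
  · refine (Finset.card_le_card fun p hp => ?_).trans hcard
    by_contra h
    simp [h] at hp
  · simp only [fip_eq_sum, Matrix.of_apply, Prod.mk.eta, mul_ite, mul_zero, Finset.sum_ite_mem,
      Finset.univ_inter]
    have : ∀ p : Fin m × Fin n, Q p.1 p.2 * (-(t / σ) * Q p.1 p.2)
        = -(t / σ) * Q p.1 p.2 ^ 2 := fun p => by ring
    simp only [this]
    rw [← Finset.mul_sum, hsq]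
    field_simp

/-- minimum of ⟨Q,X⟩_F over the Frobenius ball of radius t intersected with
the s-sparse matrices equals −t·σ_s(Q); the minimum over the corresponding sphere has the
same value. -/
theorem stmt6 (A B : ℕ) (hA : 0 < A) (hB : 0 < B)
    (Q : Matrix (Fin A) (Fin B) ℝ) (hQ : fnorm Q ≠ 0) (t : ℝ) (ht : 0 ≤ t)
    (s : ℕ) (hs : 0 < s) :
    IsLeast ((fun X : Matrix (Fin A) (Fin B) ℝ => fip Q X) ''
        {X | fnorm X ^ 2 ≤ t ^ 2 ∧ l0 X ≤ s})
      (-(t * sigS s Q)) ∧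
    IsLeast ((fun X : Matrix (Fin A) (Fin B) ℝ => fip Q X) ''
        {X | fnorm X ^ 2 = t ^ 2 ∧ l0 X ≤ s})
      (-(t * sigS s Q)) := by
  obtain ⟨X, hX, hXs, hfip⟩ := exists_fip_eq_neg_mul_sigS hs hQ t
  refine ⟨⟨⟨X, ⟨hX.le, hXs⟩, hfip⟩, ?_⟩, ⟨⟨X, ⟨hX, hXs⟩, hfip⟩, ?_⟩⟩
  · rintro _ ⟨Y, ⟨hY, hYs⟩, rfl⟩
    exact neg_mul_sigS_le_fip Q Y ht hY hYs
  · rintro _ ⟨Y, ⟨hY, hYs⟩, rfl⟩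
    exact neg_mul_sigS_le_fip Q Y ht hY.le hYs
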